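/- arXiv:1705.09949 — 3 statements merged into one kernel-verified Lean document; each statement's English description precedes it below -/
import Mathlib

section
/- Let ħ > 0 and let V = [[A, C], [Cᵀ, B]] be a real symmetric 2n×2n block matrix such that the complex matrix V + (i/2)Ω is positive semidefinite, where Ω = [[0, ħ·I], [−ħ·I, 0]]. Then (det A)·(det B) = (ħ/2)^{2n} if and only if B = (ħ²/4)·A⁻¹ and C = 0. -/
open Matrix ComplexOrder

/-- The real `2n × 2n` block matrix `Ω = [[0, hbar·I], [−hbar·I, 0]]`, viewed as a complex matrix. -/
noncomputable def OmegaC (hbar : ℝ) (n : ℕ) : Matrix (Fin n ⊕ Fin n) (Fin n ⊕ Fin n) ℂ :=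
  Matrix.fromBlocks 0 ((hbar : ℂ) • 1) (-((hbar : ℂ) • 1)) 0

/-- The real block matrix `V = [[A, C], [Cᵀ, B]]`, viewed as a complex matrix. -/
noncomputable def VC {n : ℕ} (A C B : Matrix (Fin n) (Fin n) ℝ) :
    Matrix (Fin n ⊕ Fin n) (Fin n ⊕ Fin n) ℂ :=
  (Matrix.fromBlocks A C Cᵀ B).map Complex.ofReal

/-- Real quadratic-form version of the hypothesis `V + (i/2)Ω ≥ 0`, evaluated at
`(p + iq, r)`. -/
lemma quadraticForm_nonneg {n : ℕ} {hbar : ℝ} {A B C : Matrix (Fin n) (Fin n) ℝ}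
    (hpos : (VC A C B + (Complex.I / 2) • OmegaC hbar n).PosSemidef) (p q r : Fin n → ℝ) :
    0 ≤ p ⬝ᵥ A *ᵥ p + q ⬝ᵥ A *ᵥ q + r ⬝ᵥ B *ᵥ r + 2 * (p ⬝ᵥ C *ᵥ r) + hbar * (q ⬝ᵥ r) := by
  have hmul (M : Matrix (Fin n) (Fin n) ℝ) (v : Fin n → ℝ) :
      M.map Complex.ofReal *ᵥ (Complex.ofReal ∘ v) = Complex.ofReal ∘ (M *ᵥ v) :=
    funext fun i => (RingHom.map_mulVec Complex.ofRealHom M v i).symm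
  have hdot (v w : Fin n → ℝ) :
      (Complex.ofReal ∘ v) ⬝ᵥ (Complex.ofReal ∘ w) = ((v ⬝ᵥ w : ℝ) : ℂ) :=
    (RingHom.map_dotProduct Complex.ofRealHom v w).symm
  have hC : r ⬝ᵥ Cᵀ *ᵥ p = p ⬝ᵥ C *ᵥ r := by
    rw [mulVec_transpose, dotProduct_comm, dotProduct_mulVec]
  have h := (Complex.le_def.1 (hpos.dotProduct_mulVec_nonneg
    (Sum.elim (Complex.ofReal ∘ p + Complex.I • (Complex.ofReal ∘ q)) (Complex.ofReal ∘ r)))).1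
  have hs : star (Sum.elim (Complex.ofReal ∘ p + Complex.I • (Complex.ofReal ∘ q))
      (Complex.ofReal ∘ r)) = Sum.elim (Complex.ofReal ∘ p - Complex.I • (Complex.ofReal ∘ q))
      (Complex.ofReal ∘ r) := by
    ext (i | i) <;> simp [sub_eq_add_neg]
  simp only [hs, VC, OmegaC, fromBlocks_map, fromBlocks_smul, fromBlocks_add, fromBlocks_mulVec,
    Sum.elim_comp_inl, Sum.elim_comp_inr, sumElim_dotProduct_sumElim, add_mulVec, mulVec_add,
    mulVec_smul, smul_mulVec, neg_mulVec, smul_neg, one_mulVec, smul_zero, add_zero,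
    dotProduct_add, sub_dotProduct, smul_dotProduct, dotProduct_smul,
    dotProduct_neg, hmul, hdot, smul_eq_mul] at h
  simp [hC, dotProduct_comm r q] at h
  linarith

/-- Under `V + (i/2)Ω ≥ 0`, the block `A` is positive definite. -/
lemma posDef_of_posSemidef {n : ℕ} {hbar : ℝ} (hhbar : 0 < hbar)
    {A B C : Matrix (Fin n) (Fin n) ℝ} (hA : A.IsSymm)
    (hpos : (VC A C B + (Complex.I / 2) • OmegaC hbar n).PosSemidef) : A.PosDef := by
  refine .of_dotProduct_mulVec_pos (by
    simpa [IsHermitian, conjTranspose_eq_transpose_of_trivial] using hA.eq) fun x hx => ?_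
  rw [star_trivial]
  by_contra! hneg
  have hx2 : 0 < x ⬝ᵥ x := by simpa using dotProduct_star_self_pos_iff.2 hx
  have hB : 0 ≤ x ⬝ᵥ B *ᵥ x := by simpa using quadraticForm_nonneg hpos 0 0 x
  set b := x ⬝ᵥ B *ᵥ x
  set c := x ⬝ᵥ x
  have h := quadraticForm_nonneg hpos 0 x (-(hbar * c / (b + 1)) • x)
  simp only [mulVec_smul, smul_dotProduct, dotProduct_smul, zero_dotProduct, smul_eq_mul] at h
  have hc : 0 < hbar * c := by positivity
  have ht : 0 < hbar * c / (b + 1) := by positivity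
  have ht' : hbar * c / (b + 1) * (b + 1) = hbar * c := by field_simp
  generalize hbar * c / (b + 1) = t at *
  nlinarith [show x ⬝ᵥ B *ᵥ x = b from rfl, show x ⬝ᵥ x = c from rfl, mul_pos ht ht]

/-- The quadratic form of a congruent matrix. -/
lemma dotProduct_mulVec_mulVec {m n R : Type*} [Fintype m] [Fintype n] [CommSemiring R]
    (M : Matrix m m R) (C : Matrix m n R) (x : n → R) :
    (C *ᵥ x) ⬝ᵥ M *ᵥ C *ᵥ x = x ⬝ᵥ (Cᵀ * M * C) *ᵥ x := by
  rw [← mulVec_mulVec, ← mulVec_mulVec, dotProduct_mulVec x, vecMul_transpose]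

/-- The real part of the Schur complement of `A` is positive semidefinite. -/
lemma posSemidef_schurComplement {n : ℕ} {hbar : ℝ}
    {A B C : Matrix (Fin n) (Fin n) ℝ} (hA : A.PosDef) (hB : B.IsSymm)
    (hpos : (VC A C B + (Complex.I / 2) • OmegaC hbar n).PosSemidef) :
    (B - (hbar ^ 2 / 4) • A⁻¹ - Cᵀ * A⁻¹ * C).PosSemidef := by
  have hAi : A⁻¹ᵀ = A⁻¹ := by
    simpa [IsHermitian, conjTranspose_eq_transpose_of_trivial] using hA.inv.1
  refine .of_dotProduct_mulVec_nonneg ?_ fun x => ?_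
  · simp [IsHermitian, conjTranspose_eq_transpose_of_trivial, hAi, hB.eq, mul_assoc]
  have hu : A * A⁻¹ = 1 := mul_nonsing_inv A ((isUnit_iff_isUnit_det A).1 hA.isUnit)
  have h := quadraticForm_nonneg hpos (-(A⁻¹ *ᵥ C *ᵥ x)) (-(hbar / 2) • A⁻¹ *ᵥ x) x
  have e1 := dotProduct_mulVec_mulVec A⁻¹ C x
  simp only [mulVec_smul, mulVec_neg, mulVec_mulVec, smul_dotProduct, dotProduct_smul, hu,
    neg_dotProduct, dotProduct_neg, smul_eq_mul, one_mulVec, ← mul_assoc, one_mul] at h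
  simp only [mulVec_mulVec] at e1
  rw [dotProduct_comm (C *ᵥ x)] at e1
  rw [dotProduct_comm _ x] at h
  simp only [star_trivial, sub_mulVec, dotProduct_sub, smul_mulVec, dotProduct_smul, smul_eq_mul]
  linarith

/-- A positive semidefinite perturbation of the identity with determinant one is trivial. -/
lemma Matrix.PosSemidef.eq_zero_of_det_one_add_eq_one {ι : Type*} [Fintype ι] [DecidableEq ι]
    {Q : Matrix ι ι ℝ} (hQ : Q.PosSemidef) (h : (1 + Q).det = 1) : Q = 0 := by
  have hdet : (1 + Q).det = ∏ i, (1 + hQ.1.eigenvalues i) := by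
    have h1 := congrArg (Polynomial.eval (-1)) hQ.1.charpoly_eq
    rw [eval_charpoly, Polynomial.eval_prod] at h1
    have h2 : scalar ι (-1 : ℝ) - Q = -(1 + Q) := by
      rw [map_neg, map_one, neg_add, sub_eq_add_neg]
    have h3 (i : ι) : Polynomial.eval (-1) (Polynomial.X - Polynomial.C (hQ.1.eigenvalues i)) =
        -1 * (1 + hQ.1.eigenvalues i) := by simp; ring
    simp only [RCLike.ofReal_real_eq_id, id, h2, h3, det_neg, Finset.prod_mul_distrib,
      Finset.prod_const, Finset.card_univ] at h1
    exact mul_left_cancel₀ (by simp) h1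
  rw [← hQ.1.eigenvalues_eq_zero_iff]
  by_contra hne
  obtain ⟨i, hi⟩ := Function.ne_iff.1 hne
  have hpos := (hQ.eigenvalues_nonneg i).lt_of_ne' hi
  have : (1 : ℝ) < ∏ i, (1 + hQ.1.eigenvalues i) :=
    by
    simpa using Finset.prod_lt_prod (s := Finset.univ) (f := fun _ => (1 : ℝ)) (fun _ _ => one_pos)
      (fun j _ => le_add_of_nonneg_right (hQ.eigenvalues_nonneg j))
      ⟨i, Finset.mem_univ i, lt_add_of_pos_right 1 hpos⟩
  linarith

/-- Adding a positive semidefinite matrix to a positive definite one without changing the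
determinant is only possible if the former vanishes. -/
lemma Matrix.PosDef.eq_zero_of_det_add_eq {ι : Type*} [Fintype ι] [DecidableEq ι]
    {D P : Matrix ι ι ℝ} (hD : D.PosDef) (hP : P.PosSemidef) (h : (D + P).det = D.det) :
    P = 0 := by
  open scoped MatrixOrder in
  obtain ⟨R, hR⟩ := CStarAlgebra.nonneg_iff_eq_star_mul_self.mp hD.posSemidef.nonneg
  rw [star_eq_conjTranspose] at hR
  have hdet : Rᴴ.det * R.det = D.det := by rw [hR, det_mul]
  have hd := hD.det_pos
  have hRu : IsUnit R.det := by
    rw [isUnit_iff_ne_zero]; rintro h0; simp [h0] at hdet; linarith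
  have h1 : R⁻¹ * R = 1 := nonsing_inv_mul R hRu
  have h2 : Rᴴ * R⁻¹ᴴ = 1 := by rw [← conjTranspose_mul, h1, conjTranspose_one]
  have hPQ : P = Rᴴ * (R⁻¹ᴴ * P * R⁻¹) * R := by
    rw [show Rᴴ * (R⁻¹ᴴ * P * R⁻¹) * R = (Rᴴ * R⁻¹ᴴ) * P * (R⁻¹ * R) by
      simp only [mul_assoc], h1, h2, one_mul, mul_one]
  have hQ := (hP.conjTranspose_mul_mul_same R⁻¹).eq_zero_of_det_one_add_eq_one (by
    have : D + P = Rᴴ * (1 + R⁻¹ᴴ * P * R⁻¹) * R := by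
      rw [mul_add, add_mul, ← hPQ, mul_one, ← hR]
    rw [this, det_mul, det_mul, mul_right_comm, hdet] at h
    exact mul_left_cancel₀ hd.ne' (h.trans (mul_one _).symm))
  rw [hPQ, hQ, mul_zero, zero_mul]

/-- If `V + (i/2)Ω` is positive semidefinite, then
`(det A)(det B) = (hbar/2)^(2n)` iff `B = (hbar²/4)A⁻¹` and `C = 0`. -/
theorem stmt_8 {n : ℕ} (hbar : ℝ) (hhbar : 0 < hbar)
    (A B C : Matrix (Fin n) (Fin n) ℝ) (hA : A.IsSymm) (hB : B.IsSymm)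
    (hpos : (VC A C B + (Complex.I / 2) • OmegaC hbar n).PosSemidef) :
    A.det * B.det = (hbar / 2) ^ (2 * n) ↔ B = (hbar ^ 2 / 4) • A⁻¹ ∧ C = 0 := by
  have hApos := posDef_of_posSemidef hhbar hA hpos
  have hdet : A.det * ((hbar ^ 2 / 4) • A⁻¹).det = (hbar / 2) ^ (2 * n) := by
    have := hApos.det_pos.ne'
    rw [det_smul, det_nonsing_inv, Ring.inverse_eq_inv', Fintype.card_fin, pow_mul]
    field_simp
    norm_num
  refine ⟨fun h => ?_, fun ⟨hB', _⟩ => hB' ▸ hdet⟩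
  have hS := posSemidef_schurComplement hApos hB hpos
  have hCC : (Cᵀ * A⁻¹ * C).PosSemidef := by
    simpa using hApos.inv.posSemidef.conjTranspose_mul_mul_same C
  have hP : (B - (hbar ^ 2 / 4) • A⁻¹).PosSemidef := by simpa using hS.add hCC
  have hP0 : B - (hbar ^ 2 / 4) • A⁻¹ = 0 :=
    (hApos.inv.smul (by positivity : 0 < hbar ^ 2 / 4)).eq_zero_of_det_add_eq hP <| by
      rw [add_sub_cancel]
      exact mul_left_cancel₀ hApos.det_pos.ne' (h.trans hdet.symm)
  refine ⟨sub_eq_zero.1 hP0, ?_⟩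
  rw [hP0, zero_sub] at hS
  have hCC0 : Cᵀ * A⁻¹ * C = 0 := by
    rw [← hCC.trace_eq_zero_iff]
    have h1 := hS.trace_nonneg
    rw [trace_neg] at h1
    linarith [hCC.trace_nonneg]
  refine ext_of_mulVec_single fun i => ?_
  rw [zero_mulVec]
  by_contra hne
  have hlt := hApos.inv.dotProduct_mulVec_pos hne
  rw [star_trivial, dotProduct_mulVec_mulVec, hCC0, zero_mulVec, dotProduct_zero] at hlt
  exact hlt.false
end

section
/- Let ħ > 0 and let A and B be real symmetric positive definite n×n matrices. Then there exists a real n×n matrix C such that the complex matrix [[A, C], [Cᵀ, B]] + (i/2)Ω is positive semidefinite (where Ω = [[0, ħ·I], [−ħ·I, 0]]) if and only if B − (ħ²/4)·A⁻¹ is positive semidefinite. (In particular, when B − (ħ²/4)·A⁻¹ is positive semidefinite one may take C = 0.) -/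
open Matrix ComplexOrder

/-- A real matrix is positive semidefinite iff its complexification is. -/
lemma posSemidef_map_ofReal_iff {m : Type*} [Fintype m] [DecidableEq m] {M : Matrix m m ℝ} :
    (M.map Complex.ofReal).PosSemidef ↔ M.PosSemidef := by
  constructor
  · intro h
    refine .of_dotProduct_mulVec_nonneg ?_ fun x => ?_
    · ext i j
      simpa using congrFun (congrFun h.1 i) j
    · have hx := h.dotProduct_mulVec_nonneg (fun i => (x i : ℂ))
      have he : star (fun i => (x i : ℂ)) ⬝ᵥ (M.map Complex.ofReal *ᵥ fun i => (x i : ℂ)) =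
          ((star x ⬝ᵥ (M *ᵥ x) : ℝ) : ℂ) := by
        simp [dotProduct, mulVec]
      rw [he] at hx
      exact_mod_cast hx
  · intro h
    open scoped MatrixOrder in
    obtain ⟨X, rfl⟩ := CStarAlgebra.nonneg_iff_eq_star_mul_self.mp h.nonneg
    have he : (star X * X).map Complex.ofReal =
        (X.map Complex.ofReal)ᴴ * X.map Complex.ofReal := by
      ext i j
      simp [mul_apply, star_eq_conjTranspose]
    rw [he]
    exact posSemidef_conjTranspose_mul_self _

/-- The complexification of a real positive definite matrix is positive definite. -/
lemma Matrix.PosDef.map_ofReal {m : Type*} [Fintype m] [DecidableEq m] {M : Matrix m m ℝ}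
    (hM : M.PosDef) : (M.map Complex.ofReal).PosDef :=
  (posSemidef_map_ofReal_iff.mpr hM.posSemidef).posDef_iff_isUnit.mpr
    (hM.isUnit.map (Complex.ofRealHom.mapMatrix (m := m)))

lemma map_ofReal_inv {m : Type*} [Fintype m] [DecidableEq m] {M : Matrix m m ℝ}
    (hM : IsUnit M) : (M.map Complex.ofReal)⁻¹ = M⁻¹.map Complex.ofReal := by
  refine inv_eq_right_inv ?_
  have h := congrArg Complex.ofRealHom.mapMatrix
    (M.mul_nonsing_inv ((M.isUnit_iff_isUnit_det).mp hM))
  rwa [map_mul, map_one] at h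

lemma VC_add_smul_OmegaC {n : ℕ} (hbar : ℝ) (A C B : Matrix (Fin n) (Fin n) ℝ) :
    VC A C B + (Complex.I / 2) • OmegaC hbar n =
      fromBlocks (A.map Complex.ofReal)
        (C.map Complex.ofReal + (Complex.I / 2 * hbar) • 1)
        (C.map Complex.ofReal + (Complex.I / 2 * hbar) • 1)ᴴ (B.map Complex.ofReal) := by
  ext (i | i) (j | j) <;> simp [VC, OmegaC, one_apply, eq_comm (a := i), apply_ite] <;>
    split_ifs <;> simp [*, neg_div]

/-- Averaging with the conjugate of `V + (i/2)Ω` under `diag(1, -1)` removes the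
off-diagonal real block. -/
lemma posSemidef_zero_offDiagonal {n : ℕ} {hbar : ℝ} {A C B : Matrix (Fin n) (Fin n) ℝ}
    (hA : A.IsSymm) (hB : B.IsSymm)
    (h : (VC A C B + (Complex.I / 2) • OmegaC hbar n).PosSemidef) :
    (VC A 0 B + (Complex.I / 2) • OmegaC hbar n).PosSemidef := by
  let D : Matrix (Fin n ⊕ Fin n) (Fin n ⊕ Fin n) ℂ := fromBlocks 1 0 0 (-1)
  have hsum := (h.add (h.transpose.conjTranspose_mul_mul_same D)).smul
    (show (0 : ℝ) ≤ 1 / 2 by norm_num)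
  convert hsum using 1
  have hA' (i j) : A j i = A i j := congrFun (congrFun hA i) j
  have hB' (i j) : B j i = B i j := congrFun (congrFun hB i) j
  simp only [VC_add_smul_OmegaC, D, fromBlocks_transpose, fromBlocks_conjTranspose,
    fromBlocks_multiply, fromBlocks_add, fromBlocks_smul]
  ext (i | i) (j | j) <;> simp [hA', hB', one_apply, eq_comm (a := i), apply_ite] <;>
    (try split_ifs) <;> ring_nf

/-- Schur complement criterion for `V + (i/2)Ω` with vanishing real off-diagonal block. -/
lemma posSemidef_VC_zero_iff {n : ℕ} {hbar : ℝ} {A B : Matrix (Fin n) (Fin n) ℝ}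
    (hA : A.PosDef) :
    (VC A 0 B + (Complex.I / 2) • OmegaC hbar n).PosSemidef ↔
      (B - (hbar ^ 2 / 4) • A⁻¹).PosSemidef := by
  let _ := hA.map_ofReal.isUnit.invertible
  rw [VC_add_smul_OmegaC, hA.map_ofReal.fromBlocks₁₁, map_ofReal_inv hA.isUnit,
    ← posSemidef_map_ofReal_iff]
  have hI : Complex.I / 2 * hbar * (Complex.I / 2 * hbar) = -(hbar ^ 2 / 4 : ℂ) := by
    linear_combination (hbar ^ 2 / 4 : ℂ) * Complex.I_mul_I
  refine iff_of_eq (congrArg _ ?_)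
  ext i j
  simp
  linear_combination -(A⁻¹ i j : ℂ) * hI

/-- For real symmetric positive definite `A`, `B`, there exists a real `C`
making `[[A, C], [Cᵀ, B]] + (i/2)Ω` positive semidefinite iff `B − (hbar²/4)A⁻¹` is positive
semidefinite; in that case one may take `C = 0`. -/
theorem stmt_9 {n : ℕ} (hbar : ℝ) (hhbar : 0 < hbar)
    (A B : Matrix (Fin n) (Fin n) ℝ) (hA : A.PosDef) (hB : B.PosDef) :
    ((∃ C : Matrix (Fin n) (Fin n) ℝ,
        (VC A C B + (Complex.I / 2) • OmegaC hbar n).PosSemidef) ↔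
      (B - (hbar ^ 2 / 4) • A⁻¹).PosSemidef) ∧
      ((B - (hbar ^ 2 / 4) • A⁻¹).PosSemidef →
        (VC A 0 B + (Complex.I / 2) • OmegaC hbar n).PosSemidef) := by
  have key := posSemidef_VC_zero_iff (hbar := hbar) (B := B) hA
  refine ⟨⟨fun ⟨_, hC⟩ => key.mp (posSemidef_zero_offDiagonal ?_ ?_ hC),
    fun h => ⟨0, key.mpr h⟩⟩, key.mpr⟩
  · simpa [IsHermitian, IsSymm] using hA.isHermitian
  · simpa [IsHermitian, IsSymm] using hB.isHermitian
end

section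
/- Let ħ > 0 and α ∈ ℝ with cos α ≠ 0. Let v₁, v₂ > 0 satisfy v₁·v₂ ≥ (ħ²/4)·cos²α, let V₁₁, V₂₂ ≥ 0 satisfy V₁₁·V₂₂ ≥ (ħ²/4)·cos²α, and let m₁, m₂, a, b ∈ ℝ. Then klDiv(N(m₁, v₁), N(m₁ + a, v₁ + V₁₁)) + klDiv(N(m₂, v₂), N(m₂ + b, v₂ + V₂₂)) = s(z), where z = ħ·|cos α| / (2·√(v₁·v₂)) and s(x) = ln(1 + x) − x/(1 + x), if and only if a = 0, b = 0, V₁₁ = (ħ·|cos α|/2)·√(v₁/v₂) and V₂₂ = (ħ·|cos α|/2)·√(v₂/v₁). -/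
open MeasureTheory ProbabilityTheory
open scoped ENNReal Classical

/-- The Kullback–Leibler divergence `klDiv p q = ∫ ln (dp/dq) dp` (natural logarithm), valued
in the extended nonnegative reals and equal to `+∞` when `p` is not absolutely continuous with
respect to `q` (or the log-likelihood ratio is not integrable). -/
noncomputable def klDiv {α : Type*} [MeasurableSpace α] (p q : Measure α) : ℝ≥0∞ :=
  if p ≪ q ∧ Integrable (llr p q) p then ENNReal.ofReal (∫ x, llr p q x ∂p) else ⊤

/-- The function `s(x) = ln(1 + x) − x/(1 + x)`. -/
noncomputable def sFun (x : ℝ) : ℝ := Real.log (1 + x) - x / (1 + x)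

lemma integrable_sub_sq_gaussianReal (m c : ℝ) (v : NNReal) :
    Integrable (fun x ↦ (x - c) ^ 2) (gaussianReal m v) := by
  have h : MemLp (fun x : ℝ ↦ x) 2 (gaussianReal m v) := memLp_id_gaussianReal 2
  exact (h.sub (memLp_const c)).integrable_sq

lemma integral_sub_sq_gaussianReal (m c : ℝ) (v : NNReal) :
    ∫ x, (x - c) ^ 2 ∂gaussianReal m v = v + (m - c) ^ 2 := by
  have h : MemLp (fun x : ℝ ↦ x) 2 (gaussianReal m v) := memLp_id_gaussianReal 2
  have hvar := variance_eq_sub (h.sub (memLp_const c))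
  have hint : Integrable (fun x : ℝ ↦ x) (gaussianReal m v) := h.integrable one_le_two
  have hmean : ∫ x, (x - c) ∂gaussianReal m v = m - c := by
    rw [integral_sub hint (integrable_const c), integral_id_gaussianReal]
    simp
  have hvar' : Var[(fun x : ℝ ↦ x) - fun _ ↦ c; gaussianReal m v] = v := by
    have := variance_sub_const (μ := gaussianReal m v) (X := fun x : ℝ ↦ x)
      h.aestronglyMeasurable c
    rw [variance_fun_id_gaussianReal] at this
    exact this
  rw [hvar'] at hvar
  simp only [Pi.pow_apply, Pi.sub_apply, hmean] at hvar
  linarith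

lemma log_gaussianPDFReal (m x : ℝ) {v : NNReal} (hv : v ≠ 0) :
    Real.log (gaussianPDFReal m v x) =
      -(Real.log (2 * Real.pi) + Real.log v) / 2 - (x - m) ^ 2 / (2 * v) := by
  have hv' : (0 : ℝ) < v := by positivity
  rw [gaussianPDFReal, Real.log_mul (by positivity) (by positivity), Real.log_exp, Real.log_inv,
    Real.log_sqrt (by positivity), Real.log_mul (by positivity) hv'.ne']
  ring

lemma gaussianReal_absolutelyContinuous_gaussianReal (m n : ℝ) {v w : NNReal}
    (hv : v ≠ 0) (hw : w ≠ 0) : gaussianReal m v ≪ gaussianReal n w :=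
  (gaussianReal_absolutelyContinuous m hv).trans (gaussianReal_absolutelyContinuous' n hw)

lemma llr_gaussianReal (m n : ℝ) {v w : NNReal} (hv : v ≠ 0) (hw : w ≠ 0) :
    llr (gaussianReal m v) (gaussianReal n w) =ᵐ[gaussianReal m v]
      fun x ↦ (Real.log w - Real.log v) / 2 +
        ((x - n) ^ 2 / (2 * w) - (x - m) ^ 2 / (2 * v)) := by
  apply gaussianReal_absolutelyContinuous m hv
  filter_upwards [Measure.rnDeriv_mul_rnDeriv (κ := volume)
      (gaussianReal_absolutelyContinuous_gaussianReal m n hv hw),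
    rnDeriv_gaussianReal m v, rnDeriv_gaussianReal n w] with x hx hm hn
  rw [Pi.mul_apply, hm, hn] at hx
  have hx' := congrArg ENNReal.toReal hx
  rw [ENNReal.toReal_mul, toReal_gaussianPDF, toReal_gaussianPDF] at hx'
  have hdiv := eq_div_of_mul_eq (gaussianPDFReal_pos n w x hw).ne' hx'
  simp only [llr_def]
  rw [hdiv, Real.log_div (gaussianPDFReal_pos m v x hv).ne'
    (gaussianPDFReal_pos n w x hw).ne', log_gaussianPDFReal m x hv, log_gaussianPDFReal n x hw]
  ring

lemma klDiv_gaussianReal (m n : ℝ) {v w : NNReal} (hv : v ≠ 0) (hw : w ≠ 0) :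
    klDiv (gaussianReal m v) (gaussianReal n w) = ENNReal.ofReal
      ((Real.log w - Real.log v) / 2 + ((v + (m - n) ^ 2) / (2 * w) - 1 / 2)) := by
  have hllr := llr_gaussianReal m n hv hw
  have hn := (integrable_sub_sq_gaussianReal m n v).div_const (2 * w)
  have hm := (integrable_sub_sq_gaussianReal m m v).div_const (2 * v)
  have hint := (integrable_const (μ := gaussianReal m v)
    ((Real.log w - Real.log v) / 2)).add (hn.sub hm)
  rw [klDiv, if_pos ⟨gaussianReal_absolutelyContinuous_gaussianReal m n hv hw,
    hint.congr hllr.symm⟩, integral_congr_ae hllr,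
    integral_add (g := fun x ↦ (x - n) ^ 2 / (2 * w) - (x - m) ^ 2 / (2 * v))
      (integrable_const _) (hn.sub hm), integral_sub hn hm, integral_const,
    integral_div, integral_div, integral_sub_sq_gaussianReal, integral_sub_sq_gaussianReal]
  have hv' : (v : ℝ) ≠ 0 := by exact_mod_cast hv
  congr 2
  · simp
  · field_simp
    ring

lemma klDiv_gaussianReal_add (m a : ℝ) {v V : ℝ} (hv : 0 < v) (hV : 0 ≤ V) :
    klDiv (gaussianReal m v.toNNReal) (gaussianReal (m + a) (v + V).toNNReal) =
      ENNReal.ofReal (sFun (V / v) / 2 + a ^ 2 / (2 * (v + V))) := by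
  have hw : 0 < v + V := by positivity
  rw [klDiv_gaussianReal _ _ (Real.toNNReal_pos.2 hv).ne' (Real.toNNReal_pos.2 hw).ne',
    Real.coe_toNNReal _ hv.le, Real.coe_toNNReal _ hw.le, ← Real.log_div hw.ne' hv.ne', sFun]
  have h : 1 + V / v = (v + V) / v := by field_simp
  rw [h]
  congr 1
  field_simp
  ring

lemma sFun_tangent_lt {z t : ℝ} (hz : 0 < z) (ht : 0 < t) (hne : t ≠ z) :
    sFun z + (z / (1 + z)) ^ 2 * Real.log (t / z) < sFun t := by
  have hlog : Real.log ((1 + z) / (1 + t)) < (1 + z) / (1 + t) - 1 := by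
    apply Real.log_lt_sub_one_of_pos (by positivity)
    rw [Ne, div_eq_one_iff_eq (by positivity)]
    intro h
    exact hne (by linarith)
  have hlog' := Real.log_le_sub_one_of_pos (x := t / z * ((1 + z) / (1 + t))) (by positivity)
  rw [Real.log_mul (by positivity) (by positivity)] at hlog'
  have hc : 0 < 1 - (z / (1 + z)) ^ 2 := by
    have : 1 - (z / (1 + z)) ^ 2 = (1 + 2 * z) / (1 + z) ^ 2 := by field_simp; ring
    rw [this]
    positivity
  have h₁ := mul_lt_mul_of_pos_left hlog hc
  have h₂ := mul_le_mul_of_nonneg_left hlog' (sq_nonneg (z / (1 + z)))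
  have hid : (1 - (z / (1 + z)) ^ 2) * ((1 + z) / (1 + t) - 1) +
      (z / (1 + z)) ^ 2 * (t / z * ((1 + z) / (1 + t)) - 1) =
      z / (1 + z) - t / (1 + t) := by
    field_simp
    ring
  have hd : Real.log ((1 + z) / (1 + t)) = Real.log (1 + z) - Real.log (1 + t) :=
    Real.log_div (by positivity) (by positivity)
  rw [hd] at h₁ h₂
  simp only [sFun]
  linarith

lemma sFun_nonneg {t : ℝ} (ht : 0 ≤ t) : 0 ≤ sFun t := by
  have h := Real.one_sub_inv_le_log_of_pos (x := 1 + t) (by positivity)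
  have h' : t / (1 + t) = 1 - (1 + t)⁻¹ := by field_simp; ring
  rw [sFun, h']
  linarith

lemma sFun_tangent_le {z t : ℝ} (hz : 0 < z) (ht : 0 < t) :
    sFun z + (z / (1 + z)) ^ 2 * Real.log (t / z) ≤ sFun t := by
  rcases eq_or_ne t z with rfl | hne
  · simp [ht.ne']
  · exact (sFun_tangent_lt hz ht hne).le

lemma sq_mul_log_div_add_nonneg {z t u : ℝ} (hz : 0 < z) (ht : 0 < t) (hu : 0 < u)
    (h : z ^ 2 ≤ t * u) :
    0 ≤ (z / (1 + z)) ^ 2 * Real.log (t / z) + (z / (1 + z)) ^ 2 * Real.log (u / z) := by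
  rw [← mul_add, ← Real.log_mul (by positivity) (by positivity)]
  refine mul_nonneg (sq_nonneg _) (Real.log_nonneg ?_)
  rw [div_mul_div_comm, one_le_div (by positivity)]
  linarith

lemma two_mul_sFun_le {z t u : ℝ} (hz : 0 < z) (ht : 0 < t) (hu : 0 < u)
    (h : z ^ 2 ≤ t * u) : 2 * sFun z ≤ sFun t + sFun u := by
  linarith [sFun_tangent_le hz ht, sFun_tangent_le hz hu, sq_mul_log_div_add_nonneg hz ht hu h]

lemma eq_of_sFun_add_le {z t u : ℝ} (hz : 0 < z) (ht : 0 < t) (hu : 0 < u)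
    (h : z ^ 2 ≤ t * u) (hle : sFun t + sFun u ≤ 2 * sFun z) : t = z := by
  by_contra hne
  linarith [sFun_tangent_lt hz ht hne, sFun_tangent_le hz hu, sq_mul_log_div_add_nonneg hz ht hu h]

lemma div_sqrt_mul_mul_left (k : ℝ) {v w : ℝ} (hv : 0 < v) (hw : 0 < w) :
    k / Real.sqrt (v * w) * v = k * Real.sqrt (v / w) := by
  rw [Real.sqrt_mul hv.le, Real.sqrt_div hv.le]
  have := Real.sqrt_pos.2 hv
  have := Real.sqrt_pos.2 hw
  field_simp
  rw [Real.sq_sqrt hv.le]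

/-- Characterization of the optimal Gaussian covariant joint measurement: the
sum of the two Kullback–Leibler divergences equals the lower bound `s(z)`,
`z = ħ|cos α|/(2√(v₁v₂))`, if and only if `a = 0`, `b = 0`,
`V₁₁ = (ħ|cos α|/2)√(v₁/v₂)` and `V₂₂ = (ħ|cos α|/2)√(v₂/v₁)`. -/
theorem stmt_14 (hbar α v₁ v₂ V₁₁ V₂₂ m₁ m₂ a b : ℝ) (hhbar : 0 < hbar)
    (hcos : Real.cos α ≠ 0) (hv₁ : 0 < v₁) (hv₂ : 0 < v₂)
    (hv : hbar ^ 2 / 4 * Real.cos α ^ 2 ≤ v₁ * v₂)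
    (hV₁ : 0 ≤ V₁₁) (hV₂ : 0 ≤ V₂₂)
    (hV : hbar ^ 2 / 4 * Real.cos α ^ 2 ≤ V₁₁ * V₂₂) :
    klDiv (gaussianReal m₁ v₁.toNNReal) (gaussianReal (m₁ + a) (v₁ + V₁₁).toNNReal) +
        klDiv (gaussianReal m₂ v₂.toNNReal) (gaussianReal (m₂ + b) (v₂ + V₂₂).toNNReal) =
      ENNReal.ofReal (sFun (hbar * |Real.cos α| / (2 * Real.sqrt (v₁ * v₂)))) ↔
    a = 0 ∧ b = 0 ∧
      V₁₁ = hbar * |Real.cos α| / 2 * Real.sqrt (v₁ / v₂) ∧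
      V₂₂ = hbar * |Real.cos α| / 2 * Real.sqrt (v₂ / v₁) := by
  have hk : 0 < hbar * |Real.cos α| / 2 := by positivity
  have hksq : (hbar * |Real.cos α| / 2) ^ 2 = hbar ^ 2 / 4 * Real.cos α ^ 2 := by
    rw [div_pow, mul_pow, sq_abs]
    ring
  rw [← hksq] at hV
  have hz_eq : hbar * |Real.cos α| / (2 * Real.sqrt (v₁ * v₂)) =
      hbar * |Real.cos α| / 2 / Real.sqrt (v₁ * v₂) := (div_div _ _ _).symm
  rw [hz_eq]
  set k := hbar * |Real.cos α| / 2
  have hsqrt : 0 < Real.sqrt (v₁ * v₂) := Real.sqrt_pos.2 (mul_pos hv₁ hv₂)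
  have hVV : 0 < V₁₁ * V₂₂ := lt_of_lt_of_le (by positivity) hV
  have hV₁' : 0 < V₁₁ := pos_of_mul_pos_left hVV hV₂
  have hV₂' : 0 < V₂₂ := pos_of_mul_pos_right hVV hV₁
  have e₁ : V₁₁ = k * Real.sqrt (v₁ / v₂) ↔ V₁₁ / v₁ = k / Real.sqrt (v₁ * v₂) := by
    rw [← div_sqrt_mul_mul_left k hv₁ hv₂, div_eq_iff hv₁.ne']
  have e₂ : V₂₂ = k * Real.sqrt (v₂ / v₁) ↔ V₂₂ / v₂ = k / Real.sqrt (v₁ * v₂) := by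
    rw [← div_sqrt_mul_mul_left k hv₂ hv₁, div_eq_iff hv₂.ne', mul_comm v₂ v₁]
  have ht : 0 < V₁₁ / v₁ := by positivity
  have hu : 0 < V₂₂ / v₂ := by positivity
  have hz : 0 < k / Real.sqrt (v₁ * v₂) := by positivity
  have hle : (k / Real.sqrt (v₁ * v₂)) ^ 2 ≤ V₁₁ / v₁ * (V₂₂ / v₂) := by
    rw [div_pow, Real.sq_sqrt (by positivity), div_mul_div_comm]
    gcongr
  rw [e₁, e₂, klDiv_gaussianReal_add _ _ hv₁ hV₁, klDiv_gaussianReal_add _ _ hv₂ hV₂]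
  generalize k / Real.sqrt (v₁ * v₂) = z at *
  have hs₁ := sFun_nonneg ht.le
  have hs₂ := sFun_nonneg hu.le
  have ha : 0 ≤ a ^ 2 / (2 * (v₁ + V₁₁)) := by positivity
  have hb : 0 ≤ b ^ 2 / (2 * (v₂ + V₂₂)) := by positivity
  rw [← ENNReal.ofReal_add (by positivity) (by positivity),
    ENNReal.ofReal_eq_ofReal_iff (by positivity) (sFun_nonneg hz.le)]
  constructor
  · intro h
    have hmin := two_mul_sFun_le hz ht hu hle
    have ha₀ : a ^ 2 / (2 * (v₁ + V₁₁)) = 0 := by linarith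
    have hb₀ : b ^ 2 / (2 * (v₂ + V₂₂)) = 0 := by linarith
    refine ⟨?_, ?_, eq_of_sFun_add_le hz ht hu hle (by linarith),
      eq_of_sFun_add_le hz hu ht (by linarith) (by linarith)⟩
    · rcases div_eq_zero_iff.1 ha₀ with h₀ | h₀
      · exact pow_eq_zero_iff two_ne_zero |>.1 h₀
      · linarith
    · rcases div_eq_zero_iff.1 hb₀ with h₀ | h₀
      · exact pow_eq_zero_iff two_ne_zero |>.1 h₀
      · linarith
  · rintro ⟨rfl, rfl, h₁, h₂⟩
    rw [h₁, h₂]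
    ring
end
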